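/- For the sample consisting of the three time series x^(1) = (1, 10, 0, 0, 4), x^(2) = (0, 2, 10, 0, 0), and x^(3) = (0, 0, 0, 10, 0), the time series z = (1/4, 1, 10, 0, 4/3) and x̄ = (1/3, 1/3, 1, 10, 0, 0, 4/3) satisfy Σ_{j=1}^3 dtw(z, x^(j))² < Σ_{j=1}^3 dtw(x̄, x^(j))². Hence the time series x̄ obtained by column-wise averaging the multiple alignment of the sample is not a mean. -/

import Mathlib

/-- A warping path of order `m × n` (pairs are 1-indexed): it starts at `(1,1)`,
ends at `(m,n)`, stays within `[m] × [n]`, and each step is one of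
`(+1,0)`, `(0,+1)`, `(+1,+1)`. -/
def IsWarpingPath (m n : ℕ) (p : List (ℕ × ℕ)) : Prop :=
  p.head? = some (1, 1) ∧
  p.getLast? = some (m, n) ∧
  (∀ q ∈ p, 1 ≤ q.1 ∧ q.1 ≤ m ∧ 1 ≤ q.2 ∧ q.2 ≤ n) ∧
  ∀ ℓ : ℕ, ℓ + 1 < p.length →
    ((p.getD (ℓ + 1) (0, 0)).1 = (p.getD ℓ (0, 0)).1 + 1 ∧
       (p.getD (ℓ + 1) (0, 0)).2 = (p.getD ℓ (0, 0)).2) ∨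
    ((p.getD (ℓ + 1) (0, 0)).1 = (p.getD ℓ (0, 0)).1 ∧
       (p.getD (ℓ + 1) (0, 0)).2 = (p.getD ℓ (0, 0)).2 + 1) ∨
    ((p.getD (ℓ + 1) (0, 0)).1 = (p.getD ℓ (0, 0)).1 + 1 ∧
       (p.getD (ℓ + 1) (0, 0)).2 = (p.getD ℓ (0, 0)).2 + 1)

/-- The cost `C_p(x,y)` of aligning time series `x` and `y` (1-indexed, given as
lists of rationals) along the warping path `p`. -/
def alignCost (x y : List ℚ) (p : List (ℕ × ℕ)) : ℚ :=
  (p.map fun q => (x.getD (q.1 - 1) 0 - y.getD (q.2 - 1) 0) ^ 2).sum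

/-- The squared dtw-distance: the minimum alignment cost over all warping paths
of order `x.length × y.length`. -/
noncomputable def dtwSq (x y : List ℚ) : ℝ :=
  sInf {c : ℝ | ∃ p : List (ℕ × ℕ),
    IsWarpingPath x.length y.length p ∧ c = (alignCost x y p : ℝ)}

/-- The dtw-distance. -/
noncomputable def dtw (x y : List ℚ) : ℝ := Real.sqrt (dtwSq x y)

/-- The first sample time series `x⁽¹⁾ = (1,10,0,0,4)`. -/
def xOne : List ℚ := [1, 10, 0, 0, 4]

/-- The second sample time series `x⁽²⁾ = (0,2,10,0,0)`. -/
def xTwo : List ℚ := [0, 2, 10, 0, 0]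

/-- The third sample time series `x⁽³⁾ = (0,0,0,10,0)`. -/
def xThree : List ℚ := [0, 0, 0, 10, 0]

/-- The Fréchet function of the sample `(x⁽¹⁾, x⁽²⁾, x⁽³⁾)`. -/
noncomputable def F (z : List ℚ) : ℝ :=
  dtwSq z xOne + dtwSq z xTwo + dtwSq z xThree

/-- Squared difference of the entries of `x` and `y` at a (1-indexed) pair. -/
def pairCost (x y : List ℚ) (q : ℕ × ℕ) : ℚ :=
  (x.getD (q.1 - 1) 0 - y.getD (q.2 - 1) 0) ^ 2

/-- The (1-indexed) entry of a table of rationals at a pair. -/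
def tableEntry (t : List (List ℚ)) (q : ℕ × ℕ) : ℚ :=
  (t.getD (q.1 - 1) []).getD (q.2 - 1) 0

/-- A table is a potential for `(x, y)` if its final entry is at most the final pair cost, and it
decreases along each admissible step by at most the cost of the pair being left. -/
def IsPotential (x y : List ℚ) (t : List (List ℚ)) : Prop :=
  tableEntry t (x.length, y.length) ≤ pairCost x y (x.length, y.length) ∧
  ∀ i ∈ Finset.Icc 1 x.length, ∀ j ∈ Finset.Icc 1 y.length,
    (i < x.length → tableEntry t (i, j) ≤ pairCost x y (i, j) + tableEntry t (i + 1, j)) ∧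
    (j < y.length → tableEntry t (i, j) ≤ pairCost x y (i, j) + tableEntry t (i, j + 1)) ∧
    (i < x.length → j < y.length →
      tableEntry t (i, j) ≤ pairCost x y (i, j) + tableEntry t (i + 1, j + 1))

instance (m n : ℕ) (p : List (ℕ × ℕ)) : Decidable (IsWarpingPath m n p) :=
  decidable_of_iff
    (p.head? = some (1, 1) ∧ p.getLast? = some (m, n) ∧
      (∀ q ∈ p, 1 ≤ q.1 ∧ q.1 ≤ m ∧ 1 ≤ q.2 ∧ q.2 ≤ n) ∧
      ∀ ℓ < p.length, ℓ + 1 < p.length →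
        ((p.getD (ℓ + 1) (0, 0)).1 = (p.getD ℓ (0, 0)).1 + 1 ∧
           (p.getD (ℓ + 1) (0, 0)).2 = (p.getD ℓ (0, 0)).2) ∨
        ((p.getD (ℓ + 1) (0, 0)).1 = (p.getD ℓ (0, 0)).1 ∧
           (p.getD (ℓ + 1) (0, 0)).2 = (p.getD ℓ (0, 0)).2 + 1) ∨
        ((p.getD (ℓ + 1) (0, 0)).1 = (p.getD ℓ (0, 0)).1 + 1 ∧
           (p.getD (ℓ + 1) (0, 0)).2 = (p.getD ℓ (0, 0)).2 + 1)) <| by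
    unfold IsWarpingPath
    refine and_congr_right' (and_congr_right' (and_congr_right'
      ⟨fun h ℓ hℓ => ?_, fun h ℓ _ => h ℓ⟩))
    exact h ℓ (Nat.lt_of_succ_lt hℓ) hℓ

theorem alignCost_cons (x y : List ℚ) (q : ℕ × ℕ) (p : List (ℕ × ℕ)) :
    alignCost x y (q :: p) = pairCost x y q + alignCost x y p := by
  simp [alignCost, pairCost]

theorem alignCost_nonneg (x y : List ℚ) (p : List (ℕ × ℕ)) : 0 ≤ alignCost x y p := by
  refine List.sum_nonneg fun c hc => ?_
  obtain ⟨q, -, rfl⟩ := List.mem_map.1 hc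
  positivity

theorem dtwSq_le_alignCost {x y : List ℚ} {p : List (ℕ × ℕ)}
    (hp : IsWarpingPath x.length y.length p) : dtwSq x y ≤ alignCost x y p := by
  refine csInf_le ⟨0, ?_⟩ ⟨p, hp, rfl⟩
  rintro c ⟨q, -, rfl⟩
  exact_mod_cast alignCost_nonneg x y q

/-- A potential bounds from below the cost of every path to the final pair. -/
theorem IsPotential.le_alignCost {x y : List ℚ} {t : List (List ℚ)} (ht : IsPotential x y t)
    (p : List (ℕ × ℕ)) (q : ℕ × ℕ)
    (hlast : (q :: p).getLast? = some (x.length, y.length))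
    (hmem : ∀ r ∈ q :: p, 1 ≤ r.1 ∧ r.1 ≤ x.length ∧ 1 ≤ r.2 ∧ r.2 ≤ y.length)
    (hstep : ∀ ℓ : ℕ, ℓ + 1 < (q :: p).length →
      (((q :: p).getD (ℓ + 1) (0, 0)).1 = ((q :: p).getD ℓ (0, 0)).1 + 1 ∧
         ((q :: p).getD (ℓ + 1) (0, 0)).2 = ((q :: p).getD ℓ (0, 0)).2) ∨
      (((q :: p).getD (ℓ + 1) (0, 0)).1 = ((q :: p).getD ℓ (0, 0)).1 ∧
         ((q :: p).getD (ℓ + 1) (0, 0)).2 = ((q :: p).getD ℓ (0, 0)).2 + 1) ∨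
      (((q :: p).getD (ℓ + 1) (0, 0)).1 = ((q :: p).getD ℓ (0, 0)).1 + 1 ∧
         ((q :: p).getD (ℓ + 1) (0, 0)).2 = ((q :: p).getD ℓ (0, 0)).2 + 1)) :
    tableEntry t q ≤ alignCost x y (q :: p) := by
  induction p generalizing q with
  | nil =>
    obtain rfl : q = (x.length, y.length) := by simpa using hlast
    simpa [alignCost, pairCost] using ht.1
  | cons r p ih =>
    have key : tableEntry t r ≤ alignCost x y (r :: p) := by
      refine ih r (by simpa using hlast) (fun s hs => hmem s (List.mem_cons_of_mem q hs))
        fun ℓ hℓ => ?_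
      simpa only [List.getD_cons_succ] using hstep (ℓ + 1) (by simpa using hℓ)
    have hq := hmem q (by simp)
    have hr := hmem r (by simp)
    have hqr := hstep 0 (by simp)
    obtain ⟨i, j⟩ := q
    obtain ⟨i', j'⟩ := r
    simp only [List.getD_cons_succ, List.getD_cons_zero, zero_add] at hqr hq hr
    obtain ⟨h₁, h₂, h₃⟩ := ht.2 i (Finset.mem_Icc.2 ⟨hq.1, hq.2.1⟩)
      j (Finset.mem_Icc.2 ⟨hq.2.2.1, hq.2.2.2⟩)
    rw [alignCost_cons]
    rcases hqr with ⟨rfl, rfl⟩ | ⟨rfl, rfl⟩ | ⟨rfl, rfl⟩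
    · exact (h₁ hr.2.1).trans (by gcongr)
    · exact (h₂ hr.2.2.2).trans (by gcongr)
    · exact (h₃ hr.2.1 hr.2.2.2).trans (by gcongr)

/-- The initial entry of a potential bounds the squared dtw-distance from below; a warping path is
needed because the infimum of the empty set is a junk value. -/
theorem IsPotential.le_dtwSq {x y : List ℚ} {t : List (List ℚ)} (ht : IsPotential x y t)
    {p : List (ℕ × ℕ)} (hp : IsWarpingPath x.length y.length p) :
    (tableEntry t (1, 1) : ℝ) ≤ dtwSq x y := by
  refine le_csInf ⟨_, p, hp, rfl⟩ ?_
  rintro c ⟨s, ⟨hhead, hlast, hmem, hstep⟩, rfl⟩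
  cases s with
  | nil => simp at hhead
  | cons q s =>
    obtain rfl : q = (1, 1) := by simpa using hhead
    exact_mod_cast ht.le_alignCost s _ hlast hmem hstep

theorem dtwSq_xOne_le : dtwSq [1/4, 1, 10, 0, 4/3] xOne ≤ 1105/144 := by
  have hp : IsWarpingPath 5 5 [(1, 1), (2, 1), (3, 2), (4, 3), (4, 4), (5, 5)] := by
    decide
  refine (dtwSq_le_alignCost (by exact hp)).trans ?_
  norm_num [alignCost, xOne]

theorem dtwSq_xTwo_le : dtwSq [1/4, 1, 10, 0, 4/3] xTwo ≤ 409/144 := by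
  have hp : IsWarpingPath 5 5 [(1, 1), (2, 2), (3, 3), (4, 4), (4, 5), (5, 5)] := by
    decide
  refine (dtwSq_le_alignCost (by exact hp)).trans ?_
  norm_num [alignCost, xTwo]

theorem dtwSq_xThree_le : dtwSq [1/4, 1, 10, 0, 4/3] xThree ≤ 209/72 := by
  have hp : IsWarpingPath 5 5 [(1, 1), (1, 2), (2, 3), (3, 4), (4, 5), (5, 5)] := by
    decide
  refine (dtwSq_le_alignCost (by exact hp)).trans ?_
  norm_num [alignCost, xThree]

theorem le_dtwSq_xOne : 8 ≤ dtwSq [1/3, 1/3, 1, 10, 0, 0, 4/3] xOne := by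
  have ht : IsPotential [1/3, 1/3, 1, 10, 0, 0, 4/3] xOne
     [[8, 509/3, 229/3, 229/3, 111],
      [68/9, 509/3, 686/9, 686/9, 878/9],
      [64/9, 793/9, 694/9, 685/9, 757/9],
      [793/9, 64/9, 964/9, 964/9, 676/9],
      [790/9, 964/9, 64/9, 64/9, 352/9],
      [781/9, 964/9, 64/9, 64/9, 208/9],
      [773/9, 772/9, 32/3, 80/9, 64/9]] := by
    refine ⟨by norm_num [tableEntry, pairCost, xOne], fun i hi j hj => ?_⟩
    simp only [xOne, List.length_cons, List.length_nil, Finset.mem_Icc] at hi hj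
    obtain ⟨hi₁, hi₂⟩ := hi
    obtain ⟨hj₁, hj₂⟩ := hj
    interval_cases i <;> interval_cases j <;> norm_num [tableEntry, pairCost, xOne]
  have hp : IsWarpingPath 7 5
      [(1, 1), (2, 1), (3, 1), (4, 2), (5, 3), (5, 4), (6, 4), (7, 5)] := by
    decide
  simpa [tableEntry] using ht.le_dtwSq hp

theorem le_dtwSq_xTwo : 3 ≤ dtwSq [1/3, 1/3, 1, 10, 0, 0, 4/3] xTwo := by
  have ht : IsPotential [1/3, 1/3, 1, 10, 0, 0, 4/3] xTwo
     [[3, 25/3, 589/3, 103, 103],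
      [26/9, 50/9, 1586/9, 926/9, 926/9],
      [34/9, 25/9, 745/9, 925/9, 925/9],
      [1492/9, 592/9, 16/9, 916/9, 916/9],
      [712/9, 260/3, 916/9, 16/9, 16/9],
      [712/9, 248/3, 916/9, 16/9, 16/9],
      [728/9, 712/9, 236/3, 32/9, 16/9]] := by
    refine ⟨by norm_num [tableEntry, pairCost, xTwo], fun i hi j hj => ?_⟩
    simp only [xTwo, List.length_cons, List.length_nil, Finset.mem_Icc] at hi hj
    obtain ⟨hi₁, hi₂⟩ := hi
    obtain ⟨hj₁, hj₂⟩ := hj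
    interval_cases i <;> interval_cases j <;> norm_num [tableEntry, pairCost, xTwo]
  have hp : IsWarpingPath 7 5
      [(1, 1), (2, 1), (3, 2), (4, 3), (5, 4), (5, 5), (6, 5), (7, 5)] := by
    decide
  simpa [tableEntry] using ht.le_dtwSq hp

theorem le_dtwSq_xThree : 3 ≤ dtwSq [1/3, 1/3, 1, 10, 0, 0, 4/3] xThree := by
  have ht : IsPotential [1/3, 1/3, 1, 10, 0, 0, 4/3] xThree
     [[3, 3, 3, 589/3, 103],
      [3, 26/9, 26/9, 1586/9, 926/9],
      [43/9, 34/9, 25/9, 745/9, 925/9],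
      [1592/9, 1592/9, 916/9, 16/9, 916/9],
      [692/9, 692/9, 692/9, 916/9, 16/9],
      [692/9, 692/9, 692/9, 916/9, 16/9],
      [740/9, 724/9, 236/3, 692/9, 16/9]] := by
    refine ⟨by norm_num [tableEntry, pairCost, xThree], fun i hi j hj => ?_⟩
    simp only [xThree, List.length_cons, List.length_nil, Finset.mem_Icc] at hi hj
    obtain ⟨hi₁, hi₂⟩ := hi
    obtain ⟨hj₁, hj₂⟩ := hj
    interval_cases i <;> interval_cases j <;> norm_num [tableEntry, pairCost, xThree]
  have hp : IsWarpingPath 7 5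
      [(1, 1), (2, 2), (3, 3), (4, 4), (5, 5), (6, 5), (7, 5)] := by
    decide
  simpa [tableEntry] using ht.le_dtwSq hp

/-- For `z = (1/4, 1, 10, 0, 4/3)` and the multiple-alignment average
`x̄ = (1/3, 1/3, 1, 10, 0, 0, 4/3)`, we have `F(z) < F(x̄)`; hence `x̄` is not
a mean of the sample. -/
theorem ma_average_not_mean_three :
    F [1/4, 1, 10, 0, 4/3] < F [1/3, 1/3, 1, 10, 0, 0, 4/3] ∧
    ¬ (∀ z' : List ℚ, z' ≠ [] → F [1/3, 1/3, 1, 10, 0, 0, 4/3] ≤ F z') := by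
  have hlt : F [1/4, 1, 10, 0, 4/3] < F [1/3, 1/3, 1, 10, 0, 0, 4/3] := by
    unfold F
    linarith [dtwSq_xOne_le, dtwSq_xTwo_le, dtwSq_xThree_le,
      le_dtwSq_xOne, le_dtwSq_xTwo, le_dtwSq_xThree]
  exact ⟨hlt, fun h => (h _ (by simp)).not_gt hlt⟩
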